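/- Let m ≥ 1, let α₁,…,α_m be real numbers with 0 < α_i < Q for each i, and let α = α₁+⋯+α_m. Then ∫_{(ℝ^{2n+1})^m} (∏_{i=1}^m |y_i|_h^{-α_i}) / (1 + |y₁|_h^Q + ⋯ + |y_m|_h^Q)^m dy₁⋯dy_m = Ω_Q^m · (∏_{i=1}^m Γ(1 - α_i/Q)) · Γ(α/Q) / Γ(m). -/

import Mathlib

open MeasureTheory ENNReal

/-- The Korányi (homogeneous) norm on the Heisenberg group `ℍⁿ ≃ ℝ^{2n+1}`. -/
noncomputable def hnorm (n : ℕ) (x : Fin (2*n+1) → ℝ) : ℝ :=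
  ((∑ i : Fin (2*n+1), if (i : ℕ) < 2*n then (x i)^2 else 0)^2
    + (x (Fin.last (2*n)))^2) ^ ((1:ℝ)/4)

/-- The Heisenberg dilations `δ_r`. -/
noncomputable def dil (n : ℕ) (r : ℝ) (x : Fin (2*n+1) → ℝ) : Fin (2*n+1) → ℝ :=
  fun i => if (i : ℕ) < 2*n then r * x i else r^2 * x i

/-- The norm of the weighted-type space `H^∞_α(ℍⁿ)`:
`‖f‖ = ess sup_x |x|_h^α |f x|`. -/
noncomputable def wnorm (n : ℕ) (α : ℝ) (f : (Fin (2*n+1) → ℝ) → ℝ) : ℝ≥0∞ :=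
  essSup (fun x => ENNReal.ofReal (hnorm n x ^ α * |f x|)) volume

/-- `Ω_Q`: the volume of the Korányi unit ball. -/
noncomputable def ΩQ (n : ℕ) : ℝ :=
  (volume {x : Fin (2*n+1) → ℝ | hnorm n x < 1}).toReal


lemma hnorm_nonneg' (n : ℕ) (x : Fin (2*n+1) → ℝ) : 0 ≤ hnorm n x := by
  unfold hnorm; positivity

lemma hnorm_meas (n : ℕ) : Measurable (hnorm n) := by
  unfold hnorm
  refine Measurable.pow_const (Measurable.add (Measurable.pow_const
    (Finset.measurable_sum _ fun i _ => ?_) _) (by fun_prop)) _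
  by_cases h : (i : ℕ) < 2*n
  · simp only [h, if_true]; fun_prop
  · simp only [h, if_false]; fun_prop

lemma hnorm_dil (n : ℕ) (r : ℝ) (hr : 0 < r) (x : Fin (2*n+1) → ℝ) :
    hnorm n (dil n r x) = r * hnorm n x := by
  unfold hnorm dil
  have h1 : (∑ i : Fin (2*n+1), if (i : ℕ) < 2*n then
      (if (i : ℕ) < 2*n then r * x i else r^2 * x i)^2 else 0)
      = r^2 * ∑ i : Fin (2*n+1), if (i : ℕ) < 2*n then (x i)^2 else 0 := by
    rw [Finset.mul_sum]
    refine Finset.sum_congr rfl fun i _ => ?_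
    split_ifs <;> ring
  simp only [h1]
  simp only [Fin.val_last, lt_irrefl, if_false]
  set S := ∑ i : Fin (2*n+1), if (i : ℕ) < 2*n then (x i)^2 else 0
  have h2 : (r^2 * S)^2 + (r^2 * x (Fin.last (2*n)))^2
      = r^(4:ℕ) * (S^2 + x (Fin.last (2*n))^2) := by ring
  rw [h2, Real.mul_rpow (by positivity) (by positivity)]
  congr 1
  rw [← Real.rpow_natCast, ← Real.rpow_mul hr.le]
  norm_num

lemma ball_finite (n : ℕ) : volume {x : Fin (2*n+1) → ℝ | hnorm n x < 1} ≠ ∞ := by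
  refine ne_top_of_le_ne_top
    (b := volume (Set.Icc (fun _ : Fin (2*n+1) => (-1:ℝ)) (fun _ => 1)))
    (isCompact_Icc.measure_lt_top.ne) (measure_mono ?_)
  intro x hx
  simp only [Set.mem_setOf_eq] at hx
  unfold hnorm at hx
  set S := ∑ i : Fin (2*n+1), if (i : ℕ) < 2*n then (x i)^2 else 0 with hS
  have hS0 : 0 ≤ S := Finset.sum_nonneg fun i _ => by split_ifs <;> positivity
  have h3 : S^2 + x (Fin.last (2*n))^2 < 1 := by
    by_contra! h
    exact absurd (Real.one_le_rpow h (by norm_num : (0:ℝ) ≤ 1/4)) (not_le.mpr hx)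
  have hS1 : S ≤ 1 := by nlinarith [sq_nonneg (x (Fin.last (2*n)))]
  have key : ∀ i, (x i)^2 ≤ 1 := by
    intro i
    by_cases hi : (i : ℕ) < 2*n
    · have := Finset.single_le_sum
        (f := fun i : Fin (2*n+1) => if (i : ℕ) < 2*n then (x i)^2 else 0)
        (fun i _ => by split_ifs <;> positivity) (Finset.mem_univ i)
      simp only [hi, if_true] at this
      linarith
    · have : i = Fin.last (2*n) := by
        apply Fin.ext; simp; omega
      rw [this]; nlinarith [sq_nonneg S]
  refine ⟨fun i => ?_, fun i => ?_⟩
  · exact (abs_le.mp ((sq_le_one_iff_abs_le_one _).mp (key i))).1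
  · exact (abs_le.mp ((sq_le_one_iff_abs_le_one _).mp (key i))).2

lemma ball_scale (n : ℕ) (r : ℝ) (hr : 0 < r) :
    volume {x : Fin (2*n+1) → ℝ | hnorm n x < r}
      = ENNReal.ofReal (r ^ ((2:ℝ)*n+2)) * ENNReal.ofReal (ΩQ n) := by
  set D : Fin (2*n+1) → ℝ := fun i => if (i : ℕ) < 2*n then r else r^2 with hD
  have hdet : (Matrix.diagonal D).det = r ^ ((2:ℝ)*n+2) := by
    rw [Matrix.det_diagonal, Fin.prod_univ_castSucc]
    simp only [hD, Fin.val_castSucc, Fin.is_lt, if_true, Fin.val_last, lt_irrefl, if_false]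
    rw [Finset.prod_const, Finset.card_univ, Fintype.card_fin, ← pow_add, ← Real.rpow_natCast]
    congr 1; push_cast; ring
  have hpos : 0 < r ^ ((2:ℝ)*n+2) := Real.rpow_pos_of_pos hr _
  have h := Real.smul_map_diagonal_volume_pi (D := D) (by rw [hdet]; exact hpos.ne')
  rw [hdet, abs_of_pos hpos] at h
  have hms : MeasurableSet {x : Fin (2*n+1) → ℝ | hnorm n x < r} :=
    measurableSet_lt (hnorm_meas n) measurable_const
  rw [← h, Measure.smul_apply, Measure.map_apply
    (LinearMap.continuous_on_pi _).measurable hms, smul_eq_mul]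
  congr 1
  unfold ΩQ
  rw [ENNReal.ofReal_toReal (ball_finite n)]
  congr 1
  ext x
  have : Matrix.toLin' (Matrix.diagonal D) x = dil n r x := by
    ext i
    rw [Matrix.toLin'_apply, Matrix.mulVec_diagonal]
    simp only [hD, dil]
    split_ifs <;> rfl
  simp only [Set.mem_preimage, Set.mem_setOf_eq, this, hnorm_dil n r hr]
  constructor
  · intro hx; nlinarith
  · intro hx; nlinarith

lemma map_rho (n : ℕ) (Q : ℝ) (hQ : Q = 2*n+2) :
    Measure.map (fun x => hnorm n x ^ Q) (volume : Measure (Fin (2*n+1) → ℝ))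
      = ENNReal.ofReal (ΩQ n) • (volume.restrict (Set.Ioi (0:ℝ))) := by
  have hQ0 : 0 < Q := by rw [hQ]; positivity
  have hm : Measurable (fun x => hnorm n x ^ Q) := (hnorm_meas n).pow_const _
  have h1 : ∀ r : ℝ, Measure.map (fun x => hnorm n x ^ Q) (volume : Measure (Fin (2*n+1) → ℝ))
      (Set.Iio r) = ENNReal.ofReal r * ENNReal.ofReal (ΩQ n) := by
    intro r
    rw [Measure.map_apply hm measurableSet_Iio]
    rcases le_or_gt r 0 with hr | hr
    · have : (fun x => hnorm n x ^ Q) ⁻¹' Set.Iio r = ∅ := by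
        ext x
        simp only [Set.mem_preimage, Set.mem_Iio, Set.mem_empty_iff_false, iff_false, not_lt]
        exact hr.trans (Real.rpow_nonneg (hnorm_nonneg' n x) _)
      rw [this, ENNReal.ofReal_of_nonpos hr]; simp
    · have hr' : 0 < r ^ Q⁻¹ := Real.rpow_pos_of_pos hr _
      have e : (fun x => hnorm n x ^ Q) ⁻¹' Set.Iio r = {x | hnorm n x < r ^ Q⁻¹} := by
        ext x
        simp only [Set.mem_preimage, Set.mem_Iio, Set.mem_setOf_eq]
        rw [Real.lt_rpow_inv_iff_of_pos (hnorm_nonneg' n x) hr.le hQ0]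
      rw [e, ball_scale n _ hr', ← hQ, ← Real.rpow_mul hr.le, inv_mul_cancel₀ hQ0.ne',
        Real.rpow_one]
  refine Measure.ext_of_generateFrom_of_iUnion (Set.range Set.Iio)
    (fun k : ℕ => Set.Iio (k:ℝ)) ?_ isPiSystem_Iio ?_ (fun i => ⟨_, rfl⟩) ?_ ?_
  · rw [← borel_eq_generateFrom_Iio]; exact BorelSpace.measurable_eq
  · ext x; simp only [Set.mem_iUnion, Set.mem_Iio, Set.mem_univ, iff_true]; exact exists_nat_gt x
  · intro i; rw [h1]; exact ENNReal.mul_ne_top ENNReal.ofReal_ne_top ENNReal.ofReal_ne_top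
  · rintro _ ⟨r, rfl⟩
    rw [h1, Measure.smul_apply, Measure.restrict_apply measurableSet_Iio, Set.Iio_inter_Ioi,
      Real.volume_Ioo, smul_eq_mul, mul_comm, sub_zero]

lemma gamma_integrable (a t : ℝ) (ha : 0 < a) (ht : 0 < t) :
    IntegrableOn (fun s : ℝ => s ^ (a-1) * Real.exp (-(t*s))) (Set.Ioi 0) := by
  refine Integrable.of_integral_ne_zero ?_
  rw [Real.integral_rpow_mul_exp_neg_mul_Ioi ha ht]
  have := Real.Gamma_pos_of_pos ha
  positivity

lemma factor (n : ℕ) (Q : ℝ) (hQ : Q = 2*n+2) (α : ℝ) (hα : α < Q) (t : ℝ) (ht : 0 < t) :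
    Integrable (fun y => hnorm n y ^ (-α) * Real.exp (-(t * hnorm n y ^ Q))) ∧
    ∫ y, hnorm n y ^ (-α) * Real.exp (-(t * hnorm n y ^ Q))
      = ΩQ n * ((1/t) ^ (1 - α/Q) * Real.Gamma (1 - α/Q)) := by
  have hQ0 : 0 < Q := by rw [hQ]; positivity
  have hm : Measurable (fun x => hnorm n x ^ Q) := (hnorm_meas n).pow_const _
  have ha : 0 < 1 - α/Q := by rw [sub_pos, div_lt_one hQ0]; exact hα
  have e : (fun y => hnorm n y ^ (-α) * Real.exp (-(t * hnorm n y ^ Q)))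
      = (fun s : ℝ => s ^ ((1 - α/Q) - 1) * Real.exp (-(t*s))) ∘ (fun x => hnorm n x ^ Q) := by
    ext y
    simp only [Function.comp]
    rw [← Real.rpow_mul (hnorm_nonneg' n y)]
    congr 2
    field_simp
    ring
  have hsm : Measurable (fun s : ℝ => s ^ ((1 - α/Q) - 1) * Real.exp (-(t*s))) := by fun_prop
  have hi := gamma_integrable (1 - α/Q) t ha ht
  constructor
  · rw [e, ← integrable_map_measure hsm.aestronglyMeasurable hm.aemeasurable, map_rho n Q hQ]
    exact hi.smul_measure ENNReal.ofReal_ne_top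
  · rw [e]
    simp only [Function.comp_def]
    rw [← integral_map (f := fun s : ℝ => s ^ ((1 - α/Q) - 1) * Real.exp (-(t*s)))
      hm.aemeasurable hsm.aestronglyMeasurable, map_rho n Q hQ,
      integral_smul_measure, Real.integral_rpow_mul_exp_neg_mul_Ioi ha ht, smul_eq_mul,
      ENNReal.toReal_ofReal (show 0 ≤ ΩQ n from ENNReal.toReal_nonneg)]

/-- the explicit value of the sharp Hilbert constant
`ℬ_m^{h*} = Ω_Q^m (∏ Γ(1-α_i/Q)) Γ(α/Q) / Γ(m)`. -/
theorem statement17 (n : ℕ) (hn : 1 ≤ n) (m : ℕ) (hm : 1 ≤ m)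
    (Q : ℝ) (hQ : Q = 2*n+2)
    (α : Fin m → ℝ) (hα : ∀ i, 0 < α i ∧ α i < Q) :
    (∫ y : Fin m → Fin (2*n+1) → ℝ,
        (∏ i, hnorm n (y i) ^ (-(α i))) / (1 + ∑ i, hnorm n (y i) ^ Q) ^ m)
      = ΩQ n ^ m * (∏ i, Real.Gamma (1 - α i / Q)) *
          Real.Gamma ((∑ i, α i) / Q) / Real.Gamma m := by
  have hQ0 : 0 < Q := by rw [hQ]; positivity
  have hm0 : (0:ℝ) < m := by exact_mod_cast hm
  have hGm := Real.Gamma_pos_of_pos hm0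
  have hρm : ∀ β : ℝ, Measurable (fun x => hnorm n x ^ β) := fun β => (hnorm_meas n).pow_const _
  have hρ0 : ∀ (β : ℝ) x, 0 ≤ hnorm n x ^ β := fun β x => Real.rpow_nonneg (hnorm_nonneg' n x) _
  set F : (Fin m → Fin (2*n+1) → ℝ) → ℝ → ℝ := fun y t =>
    (t ^ ((m:ℝ)-1) * Real.exp (-t)) *
      ∏ i, (hnorm n (y i) ^ (-(α i)) * Real.exp (-(t * hnorm n (y i) ^ Q))) with hF
  have hFm : Measurable (Function.uncurry F) := by
    simp only [hF, Function.uncurry_def]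
    refine Measurable.mul (by fun_prop) (Finset.measurable_prod _ fun i _ => ?_)
    have h1 : Measurable (fun p : (Fin m → Fin (2*n+1) → ℝ) × ℝ => p.1 i) := by fun_prop
    refine Measurable.mul ((hρm _).comp h1) ?_
    exact ((measurable_snd.mul ((hρm _).comp h1)).neg).exp
  -- integral in t
  have hFt : ∀ y, ∫⁻ t in Set.Ioi (0:ℝ), ENNReal.ofReal (F y t) = ENNReal.ofReal
      (Real.Gamma m * ((∏ i, hnorm n (y i) ^ (-(α i))) / (1 + ∑ i, hnorm n (y i) ^ Q) ^ m)) := by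
    intro y
    set A := 1 + ∑ i, hnorm n (y i) ^ Q with hA
    set P := ∏ i, hnorm n (y i) ^ (-(α i)) with hP
    have hP0 : 0 ≤ P := Finset.prod_nonneg fun i _ => hρ0 _ _
    have hA0 : 0 < A := by
      have : 0 ≤ ∑ i, hnorm n (y i) ^ Q := Finset.sum_nonneg fun i _ => hρ0 _ _
      linarith
    have e : ∀ t, F y t = P * (t ^ ((m:ℝ)-1) * Real.exp (-(A*t))) := by
      intro t
      simp only [hF]
      rw [Finset.prod_mul_distrib, ← Real.exp_sum, ← hP]
      have : Real.exp (-(A*t)) = Real.exp (-t) * Real.exp (∑ i, -(t * hnorm n (y i) ^ Q)) := by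
        rw [← Real.exp_add]; congr 1
        rw [Finset.sum_neg_distrib, ← Finset.mul_sum, hA]; ring
      rw [this]; ring
    simp_rw [e]
    have hi := (gamma_integrable m A hm0 hA0).const_mul P
    rw [← ofReal_integral_eq_lintegral_ofReal hi, integral_const_mul,
      Real.integral_rpow_mul_exp_neg_mul_Ioi hm0 hA0, Real.rpow_natCast]
    · congr 1; rw [one_div, inv_pow]; field_simp
    · filter_upwards [ae_restrict_mem measurableSet_Ioi] with t ht
      have ht' : (0:ℝ) < t := ht
      exact mul_nonneg hP0 (by positivity)
  -- integral in y
  have hFy : ∀ t ∈ Set.Ioi (0:ℝ), ∫⁻ y, ENNReal.ofReal (F y t) = ENNReal.ofReal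
      ((ΩQ n ^ m * ∏ i, Real.Gamma (1 - α i / Q)) *
        (t ^ ((∑ i, α i) / Q - 1) * Real.exp (-(1 * t)))) := by
    intro t ht
    have ht : (0:ℝ) < t := ht
    have hfac := fun i => factor n Q hQ (α i) (hα i).2 t ht
    have hi := (Integrable.fintype_prod (f := fun i y => hnorm n y ^ (-(α i)) *
      Real.exp (-(t * hnorm n y ^ Q))) (fun i => (hfac i).1)).const_mul
        (t ^ ((m:ℝ)-1) * Real.exp (-t))
    simp only [hF]
    rw [volume_pi, ← ofReal_integral_eq_lintegral_ofReal hi, integral_const_mul,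
      integral_fintype_prod_eq_prod (fun i y => hnorm n y ^ (-(α i)) *
      Real.exp (-(t * hnorm n y ^ Q)))]
    · congr 1
      simp_rw [fun i => (hfac i).2]
      rw [Finset.prod_mul_distrib, Finset.prod_mul_distrib, Finset.prod_const, Finset.card_univ,
        Fintype.card_fin, ← Real.rpow_sum_of_pos (by positivity), Finset.sum_sub_distrib,
        Finset.sum_const, Finset.card_univ, Fintype.card_fin, nsmul_eq_mul, mul_one,
        ← Finset.sum_div, one_div, Real.inv_rpow ht.le, ← Real.rpow_neg ht.le, one_mul]
      have : t ^ ((∑ i, α i) / Q - 1) = t ^ ((m:ℝ)-1) * t ^ (-((m:ℝ) - (∑ i, α i) / Q)) := by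
        rw [← Real.rpow_add ht]; congr 1; ring
      rw [this]; ring
    · refine Filter.Eventually.of_forall fun y => ?_
      exact mul_nonneg (by positivity) (Finset.prod_nonneg fun i _ =>
        mul_nonneg (hρ0 _ _) (Real.exp_pos _).le)
  have hs : 0 < (∑ i, α i) / Q := by
    refine div_pos (Finset.sum_pos (fun i _ => (hα i).1) ⟨⟨0, hm⟩, Finset.mem_univ _⟩) hQ0
  have hC0 : 0 ≤ ΩQ n ^ m * ∏ i, Real.Gamma (1 - α i / Q) := by
    refine mul_nonneg (pow_nonneg ENNReal.toReal_nonneg _) (Finset.prod_nonneg fun i _ => ?_)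
    refine (Real.Gamma_pos_of_pos ?_).le
    rw [sub_pos, div_lt_one hQ0]; exact (hα i).2
  have hswap := lintegral_lintegral_swap (μ := (volume : Measure (Fin m → Fin (2*n+1) → ℝ)))
    (ν := volume.restrict (Set.Ioi (0:ℝ))) (f := fun y t => ENNReal.ofReal (F y t))
    (hFm.ennreal_ofReal.aemeasurable)
  simp_rw [hFt] at hswap
  rw [setLIntegral_congr_fun measurableSet_Ioi hFy, ← ofReal_integral_eq_lintegral_ofReal
    ((gamma_integrable _ 1 hs one_pos).const_mul _), integral_const_mul,
    Real.integral_rpow_mul_exp_neg_mul_Ioi hs one_pos] at hswap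
  · have hG : ∫ y : Fin m → Fin (2*n+1) → ℝ, Real.Gamma m *
        ((∏ i, hnorm n (y i) ^ (-(α i))) / (1 + ∑ i, hnorm n (y i) ^ Q) ^ m)
        = (ΩQ n ^ m * ∏ i, Real.Gamma (1 - α i / Q)) * Real.Gamma ((∑ i, α i) / Q) := by
      rw [integral_eq_lintegral_of_nonneg_ae, hswap, ENNReal.toReal_ofReal]
      · simp
      · have := Real.Gamma_pos_of_pos hs
        exact mul_nonneg hC0 (by positivity)
      · refine Filter.Eventually.of_forall fun y => ?_
        refine mul_nonneg hGm.le (div_nonneg (Finset.prod_nonneg fun i _ => hρ0 _ _)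
          (pow_nonneg (add_nonneg zero_le_one (Finset.sum_nonneg fun i _ => hρ0 _ _)) _))
      · refine Measurable.aestronglyMeasurable ?_
        refine Measurable.const_mul (Measurable.div (Finset.measurable_prod _ fun i _ =>
          (hρm _).comp (measurable_pi_apply i)) (Measurable.pow_const (Measurable.const_add
          (Finset.measurable_sum _ fun i _ => (hρm _).comp (measurable_pi_apply i)) _) _)) _
    rw [integral_const_mul] at hG
    rw [eq_div_iff hGm.ne', mul_comm, hG]
  · filter_upwards [ae_restrict_mem measurableSet_Ioi] with t ht
    have ht' : (0:ℝ) < t := ht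
    exact mul_nonneg hC0 (by positivity)
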